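/- arXiv:math/0408091 — 3 statements merged into one kernel-verified Lean document; each statement's English description precedes it below -/
import Mathlib

section
/- Let S, ψ : ℝ² → ℝ be smooth functions and suppose ψ(x,z) = 0 for every (x,z) ∈ ∂D. Then ∫_D J(S,ψ)(x,z) · S(x,z) d(x,z) = 0. -/
open MeasureTheory

/-- The closed unit square `[0,1] × [0,1]` in `ℝ²`. -/
def unitSq : Set (ℝ × ℝ) := (Set.Icc (0:ℝ) 1) ×ˢ (Set.Icc (0:ℝ) 1)

/-- Partial derivative in the first (`x`) direction. -/
noncomputable def pdx (f : ℝ × ℝ → ℝ) (p : ℝ × ℝ) : ℝ := fderiv ℝ f p (1, 0)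

/-- Partial derivative in the second (`z`) direction. -/
noncomputable def pdz (f : ℝ × ℝ → ℝ) (p : ℝ × ℝ) : ℝ := fderiv ℝ f p (0, 1)

/-- The Jacobian operator `J(g,h) = ∂ₓg ∂_z h − ∂_z g ∂ₓ h`. -/
noncomputable def Jac (g h : ℝ × ℝ → ℝ) (p : ℝ × ℝ) : ℝ :=
  pdx g p * pdz h p - pdz g p * pdx h p

lemma pdx_pdz_comm {G : ℝ × ℝ → ℝ} (hG : ContDiff ℝ 2 G) (p : ℝ × ℝ) :
    pdx (pdz G) p = pdz (pdx G) p := by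
  have hd : DifferentiableAt ℝ (fderiv ℝ G) p :=
    (hG.fderiv_right (m := 1) (by norm_num)).differentiable (by norm_num) p
  have hsymm : IsSymmSndFDerivAt ℝ G p :=
    hG.contDiffAt.isSymmSndFDerivAt (by simp)
  have key (v w : ℝ × ℝ) :
      fderiv ℝ (fun q => fderiv ℝ G q v) p w = fderiv ℝ (fderiv ℝ G) p w v := by
    rw [fderiv_clm_apply hd (differentiableAt_const v)]
    simp
  change fderiv ℝ (fun q => fderiv ℝ G q (0, 1)) p (1, 0) =
    fderiv ℝ (fun q => fderiv ℝ G q (1, 0)) p (0, 1)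
  rw [key, key]
  exact hsymm _ _

/-- The Jacobian `J(G,ψ)` is the divergence of `(-ψ ∂_z G, ψ ∂ₓ G)`. -/
lemma Jac_eq_divergence {G ψ : ℝ × ℝ → ℝ} (hG : ContDiff ℝ 2 G) (hψ : ContDiff ℝ 1 ψ)
    (p : ℝ × ℝ) :
    pdx (fun q => -(ψ q * pdz G q)) p + pdz (fun q => ψ q * pdx G q) p = Jac G ψ p := by
  have hG' : ContDiff ℝ 1 (fderiv ℝ G) := hG.fderiv_right (by norm_num)
  have hx : DifferentiableAt ℝ (pdx G) p :=
    (hG'.clm_apply contDiff_const).differentiable (by norm_num) p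
  have hz : DifferentiableAt ℝ (pdz G) p :=
    (hG'.clm_apply contDiff_const).differentiable (by norm_num) p
  have hψd : DifferentiableAt ℝ ψ p := hψ.differentiable (by norm_num) p
  have hcomm := pdx_pdz_comm hG p
  have h₁ : pdx (fun q => -(ψ q * pdz G q)) p =
      -(ψ p * pdx (pdz G) p + pdz G p * pdx ψ p) := by
    rw [pdx, fderiv_fun_neg, fderiv_fun_mul hψd hz]
    simp [pdx]
  have h₂ : pdz (fun q => ψ q * pdx G q) p = ψ p * pdz (pdx G) p + pdx G p * pdz ψ p := by
    rw [pdz, fderiv_fun_mul hψd hx]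
    simp [pdz]
  rw [h₁, h₂, hcomm, Jac]
  ring

lemma mem_frontier_unitSq {p : ℝ × ℝ} (hp : p ∈ unitSq)
    (h : p.1 = 0 ∨ p.1 = 1 ∨ p.2 = 0 ∨ p.2 = 1) : p ∈ frontier unitSq := by
  refine ⟨subset_closure hp, fun hi => ?_⟩
  rw [unitSq, interior_prod_eq, interior_Icc] at hi
  obtain ⟨⟨_, _⟩, _, _⟩ := hi
  rcases h with h | h | h | h <;> linarith

theorem integral_Jac_eq_zero {G ψ : ℝ × ℝ → ℝ} (hG : ContDiff ℝ 2 G) (hψ : ContDiff ℝ 1 ψ)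
    (hbd : ∀ p ∈ frontier unitSq, ψ p = 0) : ∫ p in unitSq, Jac G ψ p = 0 := by
  have hG' : ContDiff ℝ 1 (fderiv ℝ G) := hG.fderiv_right (by norm_num)
  have hx : ContDiff ℝ 1 (pdx G) := hG'.clm_apply contDiff_const
  have hz : ContDiff ℝ 1 (pdz G) := hG'.clm_apply contDiff_const
  have hψ' : Continuous (fderiv ℝ ψ) := hψ.continuous_fderiv (by norm_num)
  have hf : ContDiff ℝ 1 (fun q => -(ψ q * pdz G q)) := (hψ.mul hz).neg
  have hg : ContDiff ℝ 1 (fun q => ψ q * pdx G q) := hψ.mul hx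
  have hJ : Continuous (Jac G ψ) :=
    (hx.continuous.mul (hψ'.clm_apply continuous_const)).sub
      (hz.continuous.mul (hψ'.clm_apply continuous_const))
  have hsq : unitSq = Set.Icc ((0, 0) : ℝ × ℝ) (1, 1) := by
    rw [unitSq, Set.Icc_prod_Icc]
  have hdiv := Jac_eq_divergence hG hψ
  simp only [pdx, pdz] at hdiv hf hg
  have hint := integral_divergence_prod_Icc_of_hasFDerivAt_of_le _ _ _ _
    ((0, 0) : ℝ × ℝ) (1, 1) (by simp [Prod.le_def]) hf.continuous.continuousOn
    hg.continuous.continuousOn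
    (fun x _ => (hf.differentiable (by norm_num) x).hasFDerivAt)
    (fun x _ => (hg.differentiable (by norm_num) x).hasFDerivAt)
    (by simpa only [hdiv] using hJ.continuousOn.integrableOn_compact isCompact_Icc)
  simp only [hdiv] at hint
  have hzero {x z : ℝ} (hx : x ∈ Set.Icc (0 : ℝ) 1) (hz : z ∈ Set.Icc (0 : ℝ) 1)
      (h : x = 0 ∨ x = 1 ∨ z = 0 ∨ z = 1) : ψ (x, z) = 0 :=
    hbd _ (mem_frontier_unitSq ⟨hx, hz⟩ h)
  have h₀ : (0 : ℝ) ∈ Set.Icc (0 : ℝ) 1 := by simp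
  have h₁ : (1 : ℝ) ∈ Set.Icc (0 : ℝ) 1 := by simp
  have edge {F : ℝ → ℝ} (hF : ∀ t ∈ Set.Icc (0 : ℝ) 1, F t = 0) :
      ∫ t in (0 : ℝ)..1, F t = 0 :=
    intervalIntegral.integral_zero_ae <| .of_forall fun t ht => by
      rw [Set.uIoc_of_le zero_le_one] at ht
      exact hF t ⟨ht.1.le, ht.2⟩
  rw [hsq, hint, edge, edge, edge, edge]
  · simp
  · intro t ht
    rw [hzero h₀ ht (by simp), zero_mul, neg_zero]
  · intro t ht
    rw [hzero h₁ ht (by simp), zero_mul, neg_zero]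
  · intro t ht
    rw [hzero ht h₀ (by simp), zero_mul]
  · intro t ht
    rw [hzero ht h₁ (by simp), zero_mul]

/-- `J(S,ψ) S = J(S²/2,ψ)`. -/
lemma Jac_mul_self {S : ℝ × ℝ → ℝ} (ψ : ℝ × ℝ → ℝ) {p : ℝ × ℝ} (hS : DifferentiableAt ℝ S p) :
    Jac S ψ p * S p = Jac (fun q => 2⁻¹ * (S q * S q)) ψ p := by
  have h (v : ℝ × ℝ) :
      fderiv ℝ (fun q => 2⁻¹ * (S q * S q)) p v = S p * fderiv ℝ S p v := by
    rw [fderiv_const_mul (hS.fun_mul hS), fderiv_fun_mul hS hS]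
    simp only [smul_add, add_apply, smul_apply, smul_eq_mul]
    ring
  simp only [Jac, pdx, pdz, h]
  ring

/-- Orthogonality of the nonlinear term: `⟨J(S,ψ), S⟩_{L²(D)} = 0` when `ψ`
vanishes on the boundary of the unit square. -/
theorem jacobian_orthogonality (S ψ : ℝ × ℝ → ℝ)
    (hS : ContDiff ℝ (⊤ : ℕ∞) S) (hψ : ContDiff ℝ (⊤ : ℕ∞) ψ)
    (hbd : ∀ p ∈ frontier unitSq, ψ p = 0) :
    ∫ p in unitSq, Jac S ψ p * S p = 0 := by
  simp only [fun p => Jac_mul_self ψ (hS.differentiable (by simp) p)]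
  have hS2 : ContDiff ℝ 2 S := contDiff_infty.1 hS 2
  exact integral_Jac_eq_zero (contDiff_const.mul (hS2.mul hS2))
    (contDiff_infty.1 hψ 1) hbd
end

section
/- Let u : ℝ² → ℝ be a smooth function. Then ∫₀¹ u(0,z)² dz ≤ ∫_D u(x,z)² d(x,z) + 2 (∫_D u(x,z)² d(x,z))^{1/2} · (∫_D (∂ₓu(x,z))² d(x,z))^{1/2}. -/
open MeasureTheory

/-- Cauchy–Schwarz for the integral of `|f| * |g|`, in terms of square roots. -/
theorem integral_abs_mul_abs_le_sqrt_mul_sqrt {α : Type*} [MeasurableSpace α] {μ : Measure α}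
    {f g : α → ℝ} (hf : MemLp f 2 μ) (hg : MemLp g 2 μ) :
    ∫ a, |f a| * |g a| ∂μ ≤ √(∫ a, f a ^ 2 ∂μ) * √(∫ a, g a ^ 2 ∂μ) := by
  have h := integral_mul_le_Lp_mul_Lq_of_nonneg (μ := μ) Real.HolderConjugate.two_two
    (f := fun a => |f a|) (g := fun a => |g a|)
    (.of_forall fun a => abs_nonneg _) (.of_forall fun a => abs_nonneg _)
    (by rw [ENNReal.ofReal_ofNat]; exact hf.abs) (by rw [ENNReal.ofReal_ofNat]; exact hg.abs)
  simpa [Real.sqrt_eq_rpow] using h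

/-- Integrating the derivative of `(x - 1) * v x ^ 2` over `[0,1]` recovers `v 0 ^ 2`. -/
theorem sq_eq_setIntegral_Icc_of_hasDerivAt {v v' : ℝ → ℝ} (hv : ∀ x, HasDerivAt v (v' x) x)
    (hv' : Continuous v') :
    v 0 ^ 2 = ∫ x in Set.Icc (0:ℝ) 1, (v x ^ 2 + 2 * (x - 1) * (v x * v' x)) := by
  have hvc : Continuous v := continuous_iff_continuousAt.2 fun x => (hv x).continuousAt
  have hderiv (x : ℝ) : HasDerivAt (fun x => (x - 1) * v x ^ 2)
      (v x ^ 2 + 2 * (x - 1) * (v x * v' x)) x := by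
    refine (((hasDerivAt_id x).sub_const 1).mul ((hv x).pow 2)).congr_deriv ?_
    simp only [id, Pi.pow_apply]
    push_cast
    ring
  rw [integral_Icc_eq_integral_Ioc, ← intervalIntegral.integral_of_le zero_le_one,
    intervalIntegral.integral_eq_sub_of_hasDerivAt (fun x _ => hderiv x)
      (Continuous.intervalIntegrable (by fun_prop) _ _)]
  simp

theorem hasDerivAt_pdx {u : ℝ × ℝ → ℝ} (hu : Differentiable ℝ u) (x z : ℝ) :
    HasDerivAt (fun x => u (x, z)) (pdx u (x, z)) x :=
  (hu (x, z)).hasFDerivAt.comp_hasDerivAt x ((hasDerivAt_id x).prodMk (hasDerivAt_const x z))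

theorem continuous_pdx {u : ℝ × ℝ → ℝ} (hu : ContDiff ℝ 1 u) : Continuous (pdx u) :=
  (hu.continuous_fderiv one_ne_zero).clm_apply continuous_const

/-- Continuous functions are integrable on the unit square. -/
theorem Continuous.integrableOn_unitSq {f : ℝ × ℝ → ℝ} (hf : Continuous f) :
    IntegrableOn f unitSq :=
  hf.continuousOn.integrableOn_compact (isCompact_Icc.prod isCompact_Icc)

theorem Continuous.memLp_two_unitSq {f : ℝ × ℝ → ℝ} (hf : Continuous f) :
    MemLp f 2 (volume.restrict unitSq) :=
  (memLp_two_iff_integrable_sq hf.aestronglyMeasurable).2 (hf.pow 2).integrableOn_unitSq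

/-- Fubini on the unit square, with the `x`-integral innermost. -/
theorem setIntegral_unitSq_symm {f : ℝ × ℝ → ℝ} (hf : Continuous f) :
    ∫ p in unitSq, f p = ∫ z in Set.Icc (0:ℝ) 1, ∫ x in Set.Icc (0:ℝ) 1, f (x, z) := by
  have h := hf.integrableOn_unitSq
  rw [unitSq, Measure.volume_eq_prod, IntegrableOn, ← Measure.prod_restrict] at h
  rw [unitSq, Measure.volume_eq_prod, ← Measure.prod_restrict]
  exact integral_prod_symm f h

/-- Trace-type inequality: the `L²` norm of `u` on the inlet boundary segment
`{x = 0, 0 ≤ z ≤ 1}` is controlled by interior `L²` norms. -/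
theorem trace_inequality (u : ℝ × ℝ → ℝ) (hu : ContDiff ℝ (⊤ : ℕ∞) u) :
    ∫ z in Set.Icc (0:ℝ) 1, (u (0, z)) ^ 2 ≤
      (∫ p in unitSq, (u p) ^ 2) +
        2 * Real.sqrt (∫ p in unitSq, (u p) ^ 2) *
          Real.sqrt (∫ p in unitSq, (pdx u p) ^ 2) := by
  have hu1 : ContDiff ℝ 1 u := hu.of_le (by exact_mod_cast le_top)
  have huc : Continuous u := hu1.continuous
  have hdc : Continuous (pdx u) := continuous_pdx hu1
  have hslice (z : ℝ) := sq_eq_setIntegral_Icc_of_hasDerivAt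
    (fun x => hasDerivAt_pdx (hu1.differentiable one_ne_zero) x z) (by fun_prop)
  calc ∫ z in Set.Icc (0:ℝ) 1, (u (0, z)) ^ 2
      = ∫ p in unitSq, (u p ^ 2 + 2 * (p.1 - 1) * (u p * pdx u p)) := by
        rw [setIntegral_unitSq_symm (by fun_prop)]
        exact integral_congr_ae (.of_forall hslice)
    _ ≤ ∫ p in unitSq, (u p ^ 2 + 2 * (|u p| * |pdx u p|)) := by
        refine setIntegral_mono_on (Continuous.integrableOn_unitSq (by fun_prop))
          (Continuous.integrableOn_unitSq (by fun_prop))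
          (measurableSet_Icc.prod measurableSet_Icc) fun p hp => ?_
        obtain ⟨⟨h0, h1⟩, -⟩ := hp
        rw [← abs_mul]
        nlinarith [neg_abs_le (u p * pdx u p), abs_nonneg (u p * pdx u p)]
    _ = (∫ p in unitSq, u p ^ 2) + 2 * ∫ p in unitSq, |u p| * |pdx u p| := by
        rw [integral_add (Continuous.integrableOn_unitSq (by fun_prop))
          (Continuous.integrableOn_unitSq (by fun_prop)), integral_const_mul]
    _ ≤ _ := by
        rw [mul_assoc]
        gcongr
        exact integral_abs_mul_abs_le_sqrt_mul_sqrt huc.memLp_two_unitSq hdc.memLp_two_unitSq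
end

section
/- Let H be a complete metric space, let θ : Ω → Ω be an invertible map on a set Ω, let φ : Ω → H → H be continuous for each ω, and define φ(n,ω) = φ(θ^{n−1}ω) ∘ ⋯ ∘ φ(ω) for n ≥ 1, φ(0,ω) = id. Suppose B(ω) ⊆ H are nonempty compact sets that pullback absorb themselves: for each ω there is N(ω) ∈ ℕ such that φ(n, θ^{−n}ω)(B(θ^{−n}ω)) ⊆ B(ω) for all n ≥ N(ω). Define A(ω) = ⋂_{n≥0} closure( ⋃_{m≥n} φ(m, θ^{−m}ω)(B(θ^{−m}ω)) ). Then for every ω: A(ω) is nonempty and compact, A(ω) ⊆ B(ω), A is invariant in the sense that φ(1,ω)(A(ω)) = A(θω), and A(ω) pullback attracts B: sup_{y ∈ φ(n,θ^{−n}ω)(B(θ^{−n}ω))} dist(y, A(ω)) → 0 as n → ∞. -/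
open Filter

/-- The discrete-time cocycle generated by the one-step maps `φ` over the
shift `θ`: `cocycle θ φ n ω = φ(θ^{n−1}ω) ∘ ⋯ ∘ φ(θω) ∘ φ(ω)`, with
`cocycle θ φ 0 ω = id`. -/
def cocycle {Ω H : Type*} (θ : Ω → Ω) (φ : Ω → H → H) : ℕ → Ω → H → H
  | 0, _ => id
  | n + 1, ω => cocycle θ φ n (θ ω) ∘ φ ω

open Set

/-- The points every tail `⋃ m ≥ n, S m` of the sequence accumulates at. -/
def topLimsup {X : Type*} [TopologicalSpace X] (S : ℕ → Set X) : Set X :=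
  ⋂ n : ℕ, closure (⋃ m : ℕ, ⋃ (_ : n ≤ m), S m)

section TopLimsup

variable {X Y : Type*} [TopologicalSpace X] [TopologicalSpace Y] {S : ℕ → Set X} {K : Set X}

theorem antitone_closure_iUnion_tail (S : ℕ → Set X) :
    Antitone fun n : ℕ => closure (⋃ m : ℕ, ⋃ (_ : n ≤ m), S m) := fun _ _ h =>
  closure_mono <| iUnion_mono fun _ => iUnion_subset fun hm =>
    subset_iUnion_of_subset (h.trans hm) Subset.rfl

theorem subset_closure_iUnion_tail (S : ℕ → Set X) {n m : ℕ} (h : n ≤ m) :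
    S m ⊆ closure (⋃ m : ℕ, ⋃ (_ : n ≤ m), S m) :=
  (subset_iUnion₂ (s := fun m (_ : n ≤ m) => S m) m h).trans subset_closure

theorem isClosed_topLimsup (S : ℕ → Set X) : IsClosed (topLimsup S) :=
  isClosed_iInter fun _ => isClosed_closure

theorem closure_iUnion_tail_subset (hK : IsClosed K) {N : ℕ} (hS : ∀ n ≥ N, S n ⊆ K) :
    closure (⋃ m : ℕ, ⋃ (_ : N ≤ m), S m) ⊆ K :=
  closure_minimal (iUnion₂_subset hS) hK

theorem topLimsup_subset (hK : IsClosed K) {N : ℕ} (hS : ∀ n ≥ N, S n ⊆ K) :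
    topLimsup S ⊆ K :=
  (iInter_subset _ N).trans (closure_iUnion_tail_subset hK hS)

theorem topLimsup_comp_add_one (S : ℕ → Set X) :
    topLimsup (fun n => S (n + 1)) = topLimsup S := by
  apply Subset.antisymm
  · refine iInter_mono fun n => closure_mono <| iUnion₂_subset fun m hm => ?_
    exact subset_iUnion₂ (s := fun m (_ : n ≤ m) => S m) (m + 1) (by lia)
  · refine subset_iInter fun n => (iInter_subset _ (n + 1)).trans <|
      closure_mono <| iUnion₂_subset fun m hm => ?_
    obtain ⟨k, rfl⟩ : ∃ k, m = k + 1 := ⟨m - 1, by lia⟩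
    exact subset_iUnion₂ (s := fun m (_ : n ≤ m) => S (m + 1)) k (by lia)

/-- A closed set meeting the closure of every tail of an eventually compactly bounded sequence
meets its upper limit. -/
theorem topLimsup_inter_nonempty [T2Space X] (hK : IsCompact K) {N : ℕ}
    (hS : ∀ n ≥ N, S n ⊆ K) {V : Set X} (hV : IsClosed V)
    (h : ∀ n : ℕ, (closure (⋃ m : ℕ, ⋃ (_ : n ≤ m), S m) ∩ V).Nonempty) :
    (topLimsup S ∩ V).Nonempty := by
  have hanti := antitone_closure_iUnion_tail S
  obtain ⟨x, hx⟩ := IsCompact.nonempty_iInter_of_sequence_nonempty_isCompact_isClosed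
    (fun n => closure (⋃ m : ℕ, ⋃ (_ : n + N ≤ m), S m) ∩ V)
    (fun n => inter_subset_inter_left _ (hanti (by lia)))
    (fun n => h (n + N))
    (hK.of_isClosed_subset (isClosed_closure.inter hV) <| inter_subset_left.trans <|
      closure_iUnion_tail_subset hK.isClosed fun n hn => hS n (by lia))
    (fun n => isClosed_closure.inter hV)
  rw [mem_iInter] at hx
  exact ⟨x, mem_iInter.2 fun n => hanti (Nat.le_add_right n N) (hx n).1, (hx 0).2⟩

theorem topLimsup_nonempty [T2Space X] (hK : IsCompact K) {N : ℕ}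
    (hS : ∀ n ≥ N, S n ⊆ K) (hne : ∀ n, (S n).Nonempty) : (topLimsup S).Nonempty :=
  (topLimsup_inter_nonempty hK hS isClosed_univ fun n => by
    simpa using (hne n).mono (subset_closure_iUnion_tail S le_rfl)).left

theorem eventually_subset_of_topLimsup_subset [T2Space X] (hK : IsCompact K) {N : ℕ}
    (hS : ∀ n ≥ N, S n ⊆ K) {U : Set X} (hU : IsOpen U) (hSU : topLimsup S ⊆ U) :
    ∀ᶠ n in atTop, S n ⊆ U := by
  by_contra hcon
  obtain ⟨x, hx, hxU⟩ := topLimsup_inter_nonempty hK hS hU.isClosed_compl fun n => by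
    obtain ⟨m, hm, hmU⟩ := frequently_atTop.1 (not_eventually.1 hcon) n
    obtain ⟨x, hx, hxU⟩ := not_subset.1 hmU
    exact ⟨x, subset_closure_iUnion_tail S hm hx, hxU⟩
  exact hxU (hSU hx)

theorem image_topLimsup [T2Space X] [T2Space Y] (hK : IsCompact K) {N : ℕ}
    (hS : ∀ n ≥ N, S n ⊆ K) {f : X → Y} (hf : Continuous f) :
    f '' topLimsup S = topLimsup fun n => f '' S n := by
  apply Subset.antisymm
  · refine subset_iInter fun n => (image_mono (iInter_subset _ n)).trans ?_
    simpa only [image_iUnion] using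
      image_closure_subset_closure_image (s := ⋃ m : ℕ, ⋃ (_ : n ≤ m), S m) hf
  · intro y hy
    have hanti := antitone_closure_iUnion_tail S
    obtain ⟨x, hx, hxy⟩ := topLimsup_inter_nonempty hK hS
      ((isClosed_singleton (x := y)).preimage hf) fun n => by
        have hcpt : IsCompact (closure (⋃ m : ℕ, ⋃ (_ : n + N ≤ m), S m)) :=
          hK.of_isClosed_subset isClosed_closure <|
            closure_iUnion_tail_subset hK.isClosed fun m hm => hS m (by lia)
        obtain ⟨x, hx, hxy⟩ := closure_iUnion_tail_subset (hcpt.image hf).isClosed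
          (fun m hm => image_mono (subset_closure_iUnion_tail S hm)) (mem_iInter.1 hy (n + N))
        exact ⟨x, hanti (Nat.le_add_right n N) hx, hxy⟩
    exact ⟨x, hx, hxy⟩

theorem tendsto_iSup_infDist_topLimsup {H : Type*} [MetricSpace H] {S : ℕ → Set H} {K : Set H}
    (hK : IsCompact K) {N : ℕ} (hS : ∀ n ≥ N, S n ⊆ K) (hne : ∀ n, (S n).Nonempty) :
    Tendsto (fun n => ⨆ y ∈ S n, Metric.infDist y (topLimsup S)) atTop (nhds 0) := by
  rw [Metric.tendsto_nhds]
  intro ε hε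
  filter_upwards [eventually_subset_of_topLimsup_subset hK hS Metric.isOpen_thickening
    (Metric.self_subset_thickening (half_pos hε) _)] with n hn
  have hnonneg : 0 ≤ ⨆ y ∈ S n, Metric.infDist y (topLimsup S) :=
    Real.iSup_nonneg fun _ => Real.iSup_nonneg fun _ => Metric.infDist_nonneg
  have hle : ⨆ y ∈ S n, Metric.infDist y (topLimsup S) ≤ ε / 2 :=
    Real.iSup_le (fun y => Real.iSup_le (fun hy =>
      ((Metric.mem_thickening_iff_infDist_lt (topLimsup_nonempty hK hS hne)).1 (hn hy)).le)
      (half_pos hε).le) (half_pos hε).le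
  rw [Real.dist_0_eq_abs, abs_of_nonneg hnonneg]
  linarith

end TopLimsup

theorem cocycle_succ_apply {Ω H : Type*} (θ : Ω → Ω) (φ : Ω → H → H) (n : ℕ) (ω : Ω) :
    cocycle θ φ (n + 1) ω = φ (θ^[n] ω) ∘ cocycle θ φ n ω := by
  induction n generalizing ω with
  | zero => rfl
  | succ n ih =>
    rw [cocycle, ih, Function.comp_assoc, Function.iterate_succ_apply]
    rfl

/-- **Existence of the pullback (random) attractor** (discrete time, pathwise
core, after Flandoli–Schmalfuß). If the nonempty compact sets `B(ω)` pullback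
absorb themselves, then the pullback omega-limit sets
`A(ω) = ⋂ₙ closure (⋃_{m≥n} φ(m,θ^{−m}ω)(B(θ^{−m}ω)))` are nonempty, compact,
contained in `B(ω)`, invariant, and pullback attract `B`. -/
theorem pullback_attractor
    {Ω H : Type*} [MetricSpace H] [CompleteSpace H]
    (θ θi : Ω → Ω)
    (hli : Function.LeftInverse θi θ) (hri : Function.RightInverse θi θ)
    (φ : Ω → H → H) (hφ : ∀ ω, Continuous (φ ω))
    (B : Ω → Set H) (hBne : ∀ ω, (B ω).Nonempty) (hBcp : ∀ ω, IsCompact (B ω))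
    (habs : ∀ ω, ∃ N : ℕ, ∀ n ≥ N,
      cocycle θ φ n (θi^[n] ω) '' B (θi^[n] ω) ⊆ B ω)
    (A : Ω → Set H)
    (hA : ∀ ω, A ω = ⋂ n : ℕ, closure
      (⋃ m : ℕ, ⋃ (_ : n ≤ m), cocycle θ φ m (θi^[m] ω) '' B (θi^[m] ω))) :
    ∀ ω, (A ω).Nonempty ∧ IsCompact (A ω) ∧ A ω ⊆ B ω ∧
      cocycle θ φ 1 ω '' A ω = A (θ ω) ∧
      Tendsto (fun n : ℕ =>
          ⨆ y ∈ cocycle θ φ n (θi^[n] ω) '' B (θi^[n] ω), Metric.infDist y (A ω))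
        atTop (nhds 0) := by
  have hAS : ∀ ω, A ω = topLimsup fun m => cocycle θ φ m (θi^[m] ω) '' B (θi^[m] ω) := hA
  intro ω
  obtain ⟨N, hN⟩ := habs ω
  have hne : ∀ n, (cocycle θ φ n (θi^[n] ω) '' B (θi^[n] ω)).Nonempty :=
    fun n => (hBne _).image _
  have hsub : A ω ⊆ B ω := hAS ω ▸ topLimsup_subset (hBcp ω).isClosed hN
  refine ⟨hAS ω ▸ topLimsup_nonempty (hBcp ω) hN hne,
    (hBcp ω).of_isClosed_subset (hAS ω ▸ isClosed_topLimsup _) hsub, hsub, ?_, ?_⟩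
  · have hshift : ∀ n, cocycle θ φ (n + 1) (θi^[n + 1] (θ ω)) '' B (θi^[n + 1] (θ ω)) =
        φ ω '' (cocycle θ φ n (θi^[n] ω) '' B (θi^[n] ω)) := fun n => by
      rw [Function.iterate_succ_apply, hli ω, cocycle_succ_apply, hri.iterate n ω, image_comp]
    rw [hAS (θ ω), ← topLimsup_comp_add_one, hAS ω]
    simp only [hshift]
    exact image_topLimsup (hBcp ω) hN (hφ ω)
  · rw [hAS ω]
    exact tendsto_iSup_infDist_topLimsup (hBcp ω) hN hne
end
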